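/- For all real numbers x > 0 and x̄ > 0, it holds that (1 + x̄) · (x/x̄)^{x̄/(1+x̄)} ≤ 1 + x; equivalently, G(x) := ln( ((1+x̄)/(1+x)) · (x/x̄)^{x̄/(1+x̄)} ) ≤ 0. -/

import Mathlib

/-- Key GP-approximation inequality: (1+x̄)(x/x̄)^{x̄/(1+x̄)} ≤ 1+x, equivalently
G(x) ≤ 0. -/
theorem monomial_lower_bound (x xb : ℝ) (hx : 0 < x) (hxb : 0 < xb) :
    (1 + xb) * (x / xb) ^ (xb / (1 + xb)) ≤ 1 + x ∧
    Real.log (((1 + xb) / (1 + x)) * (x / xb) ^ (xb / (1 + xb))) ≤ 0 := by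
  have key : (1 + xb) * (x / xb) ^ (xb / (1 + xb)) ≤ 1 + x := by
    have h := Real.geom_mean_le_arith_mean2_weighted (w₁ := 1 / (1 + xb)) (w₂ := xb / (1 + xb))
      (p₁ := 1) (p₂ := x / xb) (by positivity) (by positivity) (by positivity) (by positivity)
      (by field_simp)
    rw [Real.one_rpow, one_mul] at h
    calc (1 + xb) * (x / xb) ^ (xb / (1 + xb))
        ≤ (1 + xb) * (1 / (1 + xb) * 1 + xb / (1 + xb) * (x / xb)) := by gcongr
      _ = 1 + x := by field_simp
  refine ⟨key, Real.log_nonpos (by positivity) ?_⟩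
  rw [div_mul_eq_mul_div, div_le_one (by positivity)]
  exact key
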